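/- (Algorithm correctness) If the feasible set S of the max-Dombi system is nonempty, then there exists a selection e* ∈ Ē (i.e., e*(i) ∈ J̄_i for all i) such that X(e*) ∈ S and max_{j=1..n} X(e*)_j ≤ max_{j=1..n} x_j for every x ∈ S; that is, some vector X(e*) with e* ∈ Ē attains the minimum of the latticized objective z(x) = max{x_1, ..., x_n} over S. -/

import Mathlib

open scoped Classical

/-- The Dombi t-norm with parameter `l`. -/
noncomputable def dombi (l x y : ℝ) : ℝ :=
  if x = 0 ∨ y = 0 then 0
  else (1 + (((1 - x) / x) ^ l + ((1 - y) / y) ^ l) ^ (1 / l))⁻¹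

/-- The solving operation `V(b, a)` associated with the Dombi t-norm. -/
noncomputable def V (l b a : ℝ) : ℝ :=
  (1 + (((1 - b) / b) ^ l - ((1 - a) / a) ^ l) ^ (1 / l))⁻¹

/-- The feasible set `S` of the max-Dombi system `A φ x = b` inside `[0,1]^n`. -/
def feasible (l : ℝ) {m n : ℕ} (A : Fin (m + 1) → Fin (n + 1) → ℝ)
    (b : Fin (m + 1) → ℝ) : Set (Fin (n + 1) → ℝ) :=
  {x | (∀ j, x j ∈ Set.Icc (0 : ℝ) 1) ∧
    ∀ i, Finset.univ.sup' Finset.univ_nonempty (fun j => dombi l (A i j) (x j)) = b i}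

/-- The vector `x̌ᵢ(j)`: its `k`-th component is `V(bᵢ, aᵢⱼ)` if `bᵢ > 0` and `k = j`,
and `0` otherwise. -/
noncomputable def xcheck (l : ℝ) {m n : ℕ} (A : Fin (m + 1) → Fin (n + 1) → ℝ)
    (b : Fin (m + 1) → ℝ) (i : Fin (m + 1)) (j k : Fin (n + 1)) : ℝ :=
  if 0 < b i ∧ k = j then V l (b i) (A i j) else 0

/-- The candidate minimal solution `X(e)` associated with a selection `e`. -/
noncomputable def Xe (l : ℝ) {m n : ℕ} (A : Fin (m + 1) → Fin (n + 1) → ℝ)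
    (b : Fin (m + 1) → ℝ) (e : Fin (m + 1) → Fin (n + 1)) (j : Fin (n + 1)) : ℝ :=
  Finset.univ.sup' Finset.univ_nonempty (fun i => xcheck l A b i (e i) j)

/-- The reduced matrix `Ā` obtained from `A` by the simplification steps
(I), (II) and (III) of Theorem 1. -/
noncomputable def Abar (l : ℝ) {m n : ℕ} (A : Fin (m + 1) → Fin (n + 1) → ℝ)
    (b : Fin (m + 1) → ℝ) (i : Fin (m + 1)) (j : Fin (n + 1)) : ℝ :=
  if A i j < b i then 0
  else if 0 < b i ∧ ∃ i', i' ≠ i ∧ 0 < b i' ∧ b i' ≤ A i' j ∧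
      V l (b i') (A i' j) < V l (b i) (A i j) then 0
  else if 0 < b i ∧ ∃ i', i' ≠ i ∧ b i' = 0 ∧ 0 < A i' j then 0
  else A i j

theorem dombi_nonneg {l x y : ℝ} (hx : x ∈ Set.Icc (0 : ℝ) 1) (hy : y ∈ Set.Icc (0 : ℝ) 1) :
    0 ≤ dombi l x y := by
  unfold dombi
  split_ifs
  · exact le_rfl
  · have h1 : 0 ≤ (1 - x) / x := div_nonneg (by linarith [hx.2]) hx.1
    have h2 : 0 ≤ (1 - y) / y := div_nonneg (by linarith [hy.2]) hy.1
    positivity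

theorem dombi_zero_left (l y : ℝ) : dombi l 0 y = 0 := by simp [dombi]

theorem dombi_strictMonoOn {l x : ℝ} (hl : 0 < l) (hx0 : 0 < x) (hx1 : x ≤ 1) :
    StrictMonoOn (dombi l x) (Set.Icc 0 1) := by
  intro y hy z hz hyz
  have hz0 : 0 < z := hy.1.trans_lt hyz
  have h1 : 0 ≤ (1 - x) / x := div_nonneg (by linarith) hx0.le
  have h3 : 0 ≤ (1 - z) / z := div_nonneg (by linarith [hz.2]) hz0.le
  rcases hy.1.eq_or_lt with rfl | hy0
  · simp only [dombi, or_true, if_true, hx0.ne', hz0.ne', or_self, if_false]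
    positivity
  · simp only [dombi, hx0.ne', hy0.ne', hz0.ne', or_self, if_false]
    have hzy : (1 - z) / z < (1 - y) / y := by
      rw [div_lt_div_iff₀ hz0 hy0]
      linarith
    have hpow := Real.rpow_lt_rpow h3 hzy hl
    have hsum : (((1 - x) / x) ^ l + ((1 - z) / z) ^ l) ^ (1 / l) <
        (((1 - x) / x) ^ l + ((1 - y) / y) ^ l) ^ (1 / l) :=
      Real.rpow_lt_rpow (by positivity) (by linarith) (by positivity)
    exact inv_strictAnti₀ (by positivity) (by linarith)

theorem dombi_monotoneOn {l x : ℝ} (hl : 0 < l) (hx : x ∈ Set.Icc (0 : ℝ) 1) :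
    MonotoneOn (dombi l x) (Set.Icc 0 1) := by
  rcases hx.1.eq_or_lt with rfl | hx0
  · intro y _ z _ _
    simp [dombi_zero_left]
  · exact (dombi_strictMonoOn hl hx0 hx.2).monotoneOn

theorem dombi_one_right {l x : ℝ} (hl : 0 < l) (hx : x ∈ Set.Icc (0 : ℝ) 1) :
    dombi l x 1 = x := by
  rcases hx.1.eq_or_lt with rfl | hx0
  · exact dombi_zero_left l 1
  · have h1 : 0 ≤ (1 - x) / x := div_nonneg (by linarith [hx.2]) hx0.le
    simp only [dombi, hx0.ne', one_ne_zero, or_self, if_false, sub_self, zero_div,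
      Real.zero_rpow hl.ne', add_zero, one_div, Real.rpow_rpow_inv h1 hl.ne']
    field_simp
    ring

theorem dombi_le_left {l x y : ℝ} (hl : 0 < l) (hx : x ∈ Set.Icc (0 : ℝ) 1)
    (hy : y ∈ Set.Icc (0 : ℝ) 1) : dombi l x y ≤ x :=
  (dombi_monotoneOn hl hx hy ⟨zero_le_one, le_rfl⟩ hy.2).trans_eq (dombi_one_right hl hx)

theorem rpow_sub_rpow_nonneg {l a b : ℝ} (hl : 0 < l) (hb : 0 < b) (hba : b ≤ a)
    (ha : a ≤ 1) : 0 ≤ ((1 - b) / b) ^ l - ((1 - a) / a) ^ l := by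
  have ha0 : 0 < a := hb.trans_le hba
  refine sub_nonneg.2 (Real.rpow_le_rpow (div_nonneg (by linarith) ha0.le) ?_ hl.le)
  rw [div_le_div_iff₀ ha0 hb]
  linarith

theorem V_pos {l a b : ℝ} (hl : 0 < l) (hb : 0 < b) (hba : b ≤ a) (ha : a ≤ 1) :
    0 < V l b a := by
  have := rpow_sub_rpow_nonneg hl hb hba ha
  unfold V
  positivity

theorem V_le_one {l a b : ℝ} (hl : 0 < l) (hb : 0 < b) (hba : b ≤ a) (ha : a ≤ 1) :
    V l b a ≤ 1 := by
  have := Real.rpow_nonneg (rpow_sub_rpow_nonneg hl hb hba ha) (1 / l)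
  exact inv_le_one_of_one_le₀ (by linarith)

theorem V_mem_Icc {l a b : ℝ} (hl : 0 < l) (hb : 0 < b) (hba : b ≤ a) (ha : a ≤ 1) :
    V l b a ∈ Set.Icc (0 : ℝ) 1 :=
  ⟨(V_pos hl hb hba ha).le, V_le_one hl hb hba ha⟩

theorem dombi_V {l a b : ℝ} (hl : 0 < l) (hb : 0 < b) (hba : b ≤ a) (ha : a ≤ 1) :
    dombi l a (V l b a) = b := by
  have hD := rpow_sub_rpow_nonneg hl hb hba ha
  have hV := V_pos hl hb hba ha
  have hb1 : 0 ≤ (1 - b) / b := div_nonneg (by linarith) hb.le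
  have hVD : (1 - V l b a) / V l b a =
      (((1 - b) / b) ^ l - ((1 - a) / a) ^ l) ^ (1 / l) := by
    rw [sub_div, div_self hV.ne', one_div, V, inv_inv, add_sub_cancel_left]
  simp only [dombi, (hb.trans_le hba).ne', hV.ne', or_self, if_false, hVD, one_div,
    Real.rpow_inv_rpow hD hl.ne', add_sub_cancel, Real.rpow_rpow_inv hb1 hl.ne']
  field_simp
  ring

/-- The solution of `dombi l a y = b` in `y` is unique when `b > 0`. -/
theorem eq_V_of_dombi_eq {l a b y : ℝ} (hl : 0 < l) (hb : 0 < b)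
    (ha : a ∈ Set.Icc (0 : ℝ) 1) (hy : y ∈ Set.Icc (0 : ℝ) 1) (h : dombi l a y = b) :
    y = V l b a := by
  have hba : b ≤ a := h ▸ dombi_le_left hl ha hy
  exact (dombi_strictMonoOn hl (hb.trans_le hba) ha.2).injOn hy (V_mem_Icc hl hb hba ha.2)
    (h.trans (dombi_V hl hb hba ha.2).symm)

section System

variable {l : ℝ} {m n : ℕ} {A : Fin (m + 1) → Fin (n + 1) → ℝ} {b : Fin (m + 1) → ℝ}

theorem dombi_le_of_mem_feasible {x : Fin (n + 1) → ℝ} (hx : x ∈ feasible l A b)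
    (i : Fin (m + 1)) (j : Fin (n + 1)) : dombi l (A i j) (x j) ≤ b i :=
  hx.2 i ▸ Finset.le_sup' (fun j => dombi l (A i j) (x j)) (Finset.mem_univ j)

theorem exists_dombi_eq_of_mem_feasible {x : Fin (n + 1) → ℝ} (hx : x ∈ feasible l A b)
    (i : Fin (m + 1)) : ∃ j, dombi l (A i j) (x j) = b i := by
  obtain ⟨j, -, hj⟩ := Finset.exists_mem_eq_sup' Finset.univ_nonempty
    (fun j => dombi l (A i j) (x j))
  exact ⟨j, hj.symm.trans (hx.2 i)⟩

/-- The reduction of `A` keeps every entry at which a feasible point attains `b i`. -/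
theorem le_Abar_of_dombi_eq (hl : 0 < l) (hA : ∀ i j, A i j ∈ Set.Icc (0 : ℝ) 1)
    (hb : ∀ i, b i ∈ Set.Icc (0 : ℝ) 1) {x : Fin (n + 1) → ℝ} (hx : x ∈ feasible l A b)
    {i : Fin (m + 1)} {j : Fin (n + 1)} (h : dombi l (A i j) (x j) = b i) :
    b i ≤ Abar l A b i j := by
  have hba : b i ≤ A i j := h ▸ dombi_le_left hl (hA i j) (hx.1 j)
  rcases (hb i).1.eq_or_lt with h0 | hpos
  · unfold Abar
    split_ifs <;> linarith
  have hxV := eq_V_of_dombi_eq hl hpos (hA i j) (hx.1 j) h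
  rw [Abar, if_neg hba.not_gt, if_neg, if_neg]
  · exact hba
  · rintro ⟨-, k, -, hk0, hk⟩
    have hxpos : 0 < x j := hxV ▸ V_pos hl hpos hba (hA i j).2
    have hlt := dombi_strictMonoOn hl hk (hA k j).2 ⟨le_rfl, zero_le_one⟩ (hx.1 j) hxpos
    have hle := dombi_le_of_mem_feasible hx k j
    have hnn := dombi_nonneg (l := l) (hA k j) ⟨le_rfl, zero_le_one⟩
    linarith
  · rintro ⟨-, k, -, hk0, hk, hV⟩
    rw [← hxV] at hV
    have hlt := dombi_strictMonoOn hl (hk0.trans_le hk) (hA k j).2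
      (V_mem_Icc hl hk0 hk (hA k j).2) (hx.1 j) hV
    rw [dombi_V hl hk0 hk (hA k j).2] at hlt
    exact hlt.not_ge (dombi_le_of_mem_feasible hx k j)

/-- Every feasible point dominates a feasible `X(e)` with `e` in the reduced selection set. -/
theorem exists_Xe_le_of_mem_feasible (hl : 0 < l) (hA : ∀ i j, A i j ∈ Set.Icc (0 : ℝ) 1)
    (hb : ∀ i, b i ∈ Set.Icc (0 : ℝ) 1) {x : Fin (n + 1) → ℝ} (hx : x ∈ feasible l A b) :
    ∃ e : Fin (m + 1) → Fin (n + 1), (∀ i, b i ≤ Abar l A b i (e i)) ∧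
      Xe l A b e ∈ feasible l A b ∧ ∀ j, Xe l A b e j ≤ x j := by
  choose e he using exists_dombi_eq_of_mem_feasible hx
  have hle : ∀ j, Xe l A b e j ≤ x j := by
    refine fun j => Finset.sup'_le _ _ fun i _ => ?_
    unfold xcheck
    split_ifs with h
    · obtain ⟨hpos, rfl⟩ := h
      exact (eq_V_of_dombi_eq hl hpos (hA i _) (hx.1 _) (he i)).ge
    · exact (hx.1 j).1
  have hnn : ∀ j, 0 ≤ Xe l A b e j := by
    refine fun j => Finset.le_sup'_of_le _ (Finset.mem_univ 0) ?_
    unfold xcheck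
    split_ifs with h
    · obtain ⟨hpos, rfl⟩ := h
      rw [← eq_V_of_dombi_eq hl hpos (hA 0 _) (hx.1 _) (he 0)]
      exact (hx.1 _).1
    · exact le_rfl
  have hmem : ∀ j, Xe l A b e j ∈ Set.Icc (0 : ℝ) 1 :=
    fun j => ⟨hnn j, (hle j).trans (hx.1 j).2⟩
  refine ⟨e, fun i => le_Abar_of_dombi_eq hl hA hb hx (he i), ⟨hmem, fun i => ?_⟩, hle⟩
  apply le_antisymm
  · exact Finset.sup'_le _ _ fun j _ =>
      (dombi_monotoneOn hl (hA i j) (hmem j) (hx.1 j) (hle j)).trans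
        (dombi_le_of_mem_feasible hx i j)
  · refine Finset.le_sup'_of_le _ (Finset.mem_univ (e i)) ?_
    rcases (hb i).1.eq_or_lt with h0 | hpos
    · rw [← h0]
      exact dombi_nonneg (hA i _) (hmem _)
    · have hge : x (e i) ≤ Xe l A b e (e i) := by
        refine Finset.le_sup'_of_le _ (Finset.mem_univ i) ?_
        rw [xcheck, if_pos ⟨hpos, rfl⟩]
        exact (eq_V_of_dombi_eq hl hpos (hA i _) (hx.1 _) (he i)).le
      rw [(hle _).antisymm hge, he i]

end System

/-- (Algorithm correctness) If `S` is nonempty, some `X(e*)` with `e* ∈ Ē` is feasible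
and minimizes the latticized objective `z(x) = max {x₁, …, xₙ}` over `S`. -/
theorem algorithm_correct (l : ℝ) (hl : 0 < l) {m n : ℕ}
    (A : Fin (m + 1) → Fin (n + 1) → ℝ) (b : Fin (m + 1) → ℝ)
    (hA : ∀ i j, A i j ∈ Set.Icc (0 : ℝ) 1) (hb : ∀ i, b i ∈ Set.Icc (0 : ℝ) 1)
    (hS : (feasible l A b).Nonempty) :
    ∃ e : Fin (m + 1) → Fin (n + 1), (∀ i, b i ≤ Abar l A b i (e i)) ∧
      Xe l A b e ∈ feasible l A b ∧
      ∀ x ∈ feasible l A b,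
        Finset.univ.sup' Finset.univ_nonempty (Xe l A b e) ≤
          Finset.univ.sup' Finset.univ_nonempty x := by
  obtain ⟨x₀, hx₀⟩ := hS
  obtain ⟨e₀, he₀, hf₀, -⟩ := exists_Xe_le_of_mem_feasible hl hA hb hx₀
  obtain ⟨e, ⟨he, hf⟩, hmin⟩ := Set.exists_min_image
    {e : Fin (m + 1) → Fin (n + 1) |
      (∀ i, b i ≤ Abar l A b i (e i)) ∧ Xe l A b e ∈ feasible l A b}
    (fun e => Finset.univ.sup' Finset.univ_nonempty (Xe l A b e)) (Set.toFinite _)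
    ⟨e₀, he₀, hf₀⟩
  refine ⟨e, he, hf, fun x hx => ?_⟩
  obtain ⟨e', he', hf', hle⟩ := exists_Xe_le_of_mem_feasible hl hA hb hx
  exact (hmin e' ⟨he', hf'⟩).trans (Finset.sup'_mono_fun fun j _ => hle j)
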